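/- Let q ∈ ℂ with q ≠ 0, and set Δ := (q + q^{-1})/2 and λ := q − q^{-1}. Let a, b, c, d ∈ Matrix (Fin D) (Fin D) ℂ satisfy the SL(2)_q quantum-group relations: a·b = q·b·a, a·c = q·c·a, b·d = q·d·b, c·d = q·d·c, b·c = c·b, and a·d − d·a = λ·b·c. Define the MPO tensor T : Fin 2 → Fin 2 → Matrix (Fin D) (Fin D) ℂ by T^{00} = a, T^{01} = b, T^{10} = c, T^{11} = d, and the tensor B by B^{00} = 0, B^{01} = λ·b, B^{10} = −λ·c, B^{11} = 0. Let h be the XXZ two-site operator on ℂ² ⊗ ℂ² determined by h|00⟩ = Δ|00⟩, h|11⟩ = Δ|11⟩, h|01⟩ = 2|10⟩ − Δ|01⟩, h|10⟩ = 2|01⟩ − Δ|10⟩. Then T and B satisfy the local MPO-symmetry equation: for all i_1, i_2, j_1, j_2 ∈ Fin 2, Σ_{k_1, k_2 ∈ Fin 2} h^{i_1 i_2}_{k_1 k_2} T^{k_1 j_1} T^{k_2 j_2} − Σ_{k_1, k_2 ∈ Fin 2} T^{i_1 k_1} T^{i_2 k_2} h^{k_1 k_2}_{j_1 j_2} = T^{i_1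 j_1} B^{i_2 j_2} − B^{i_1 j_1} T^{i_2 j_2} (matrix products). -/

import Mathlib

open Matrix

/-- The XXZ two-site operator on `ℂ² ⊗ ℂ²` with anisotropy `Δ`, determined by
`h|00⟩ = Δ|00⟩`, `h|11⟩ = Δ|11⟩`, `h|01⟩ = 2|10⟩ − Δ|01⟩`, `h|10⟩ = 2|01⟩ − Δ|10⟩`;
entries are `h^{x_0 x_1}_{y_0 y_1} = ⟨x_0 x_1| h |y_0 y_1⟩`. -/
noncomputable def xxzH (Δ : ℂ) : Matrix (Fin 2 → Fin 2) (Fin 2 → Fin 2) ℂ :=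
  Matrix.of fun x y =>
    if x = y then (if x 0 = x 1 then Δ else -Δ)
    else if x 0 ≠ x 1 ∧ y 0 = x 1 ∧ y 1 = x 0 then 2 else 0

/-- The entries of the XXZ operator in terms of the site labels. -/
lemma xxzH_apply (Δ : ℂ) (i₁ i₂ j₁ j₂ : Fin 2) :
    xxzH Δ ![i₁, i₂] ![j₁, j₂] =
      if i₁ = j₁ ∧ i₂ = j₂ then (if i₁ = i₂ then Δ else -Δ)
      else if i₁ ≠ i₂ ∧ j₁ = i₂ ∧ j₂ = i₁ then 2 else 0 := by
  simp [xxzH, funext_iff]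

/-- If `a, b, c, d` satisfy the `SL(2)_q` quantum-group
relations (with `q ≠ 0`, `Δ = (q + q⁻¹)/2`, `λ = q − q⁻¹`), then the MPO tensor
`T = (a b; c d)` together with `B = (0, λb; −λc, 0)` satisfies the local
MPO-symmetry equation for the XXZ two-site operator `h`. -/
theorem xxz_quantum_group_symmetry
    (D : ℕ) (hD : 1 ≤ D) (q : ℂ) (hq : q ≠ 0)
    (a b c d : Matrix (Fin D) (Fin D) ℂ)
    (hab : a * b = q • (b * a)) (hac : a * c = q • (c * a))
    (hbd : b * d = q • (d * b)) (hcd : c * d = q • (d * c))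
    (hbc : b * c = c * b)
    (had : a * d - d * a = (q - q⁻¹) • (b * c))
    (T B : Fin 2 → Fin 2 → Matrix (Fin D) (Fin D) ℂ)
    (hT : T = ![![a, b], ![c, d]])
    (hB : B = ![![0, (q - q⁻¹) • b], ![-((q - q⁻¹) • c), 0]]) :
    ∀ i1 i2 j1 j2 : Fin 2,
      (∑ k1 : Fin 2, ∑ k2 : Fin 2,
          xxzH ((q + q⁻¹) / 2) ![i1, i2] ![k1, k2] • (T k1 j1 * T k2 j2))
        - (∑ k1 : Fin 2, ∑ k2 : Fin 2,
          xxzH ((q + q⁻¹) / 2) ![k1, k2] ![j1, j2] • (T i1 k1 * T i2 k2))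
      = T i1 j1 * B i2 j2 - B i1 j1 * T i2 j2 := by
  have had' : a * d = d * a + (q - q⁻¹) • (c * b) := by
    rw [← hbc, ← had]; abel
  intro i1 i2 j1 j2
  subst hT hB
  fin_cases i1 <;> fin_cases i2 <;> fin_cases j1 <;> fin_cases j2 <;>
    simp [Fin.sum_univ_two, xxzH_apply, hab, hac, hbd, hcd, hbc, had'] <;>
    match_scalars <;> field_simp <;> ring
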